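/- In V = F_3^5 with quadratic form q(a) = a_0^2 - a_1^2 - ... - a_4^2, the stabilizer in O(V,q) of the standard cross {±e_0, ±e_1, ±e_2, ±e_3, ±e_4} is the group of signed permutation matrices fixing the pair {±e_0}, isomorphic to (Z/2)^5 ⋊ S_4, of order 2^5 · 24 = 768, and hence has index |O(V,q)|/768 = 135 in O(V,q), where |O(V,q)| = 103680. -/

import Mathlib

abbrev V : Type := Fin 5 → ZMod 3

def q (a : V) : ZMod 3 := a 0 ^ 2 - a 1 ^ 2 - a 2 ^ 2 - a 3 ^ 2 - a 4 ^ 2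

def e (i : Fin 5) : V := fun j => if j = i then 1 else 0

def standardCross : Finset (Finset V) :=
  Finset.univ.image fun i : Fin 5 => ({e i, -e i} : Finset V)

def PreservesQ (g : V ≃ₗ[ZMod 3] V) : Prop := ∀ v, q (g v) = q v

def StabilizesCross (g : V ≃ₗ[ZMod 3] V) : Prop :=
  standardCross.image (fun p => p.image (⇑g)) = standardCross

/-- The symmetric bilinear form with `bilin v v = q v`. -/
def bilin (v w : V) : ZMod 3 := v 0 * w 0 - v 1 * w 1 - v 2 * w 2 - v 3 * w 3 - v 4 * w 4

lemma three_eq_zero : (3 : ZMod 3) = 0 := by decide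

lemma q_neg (v : V) : q (-v) = q v := by simp [q]

lemma q_add_smul (v u : V) (c : ZMod 3) : q (v + c • u) = q v + 2 * c * bilin u v + c ^ 2 * q u := by
  simp only [q, bilin, Pi.add_apply, Pi.smul_apply, smul_eq_mul]
  ring

lemma q_add (v w : V) : q (v + w) = q v + 2 * bilin v w + q w := by
  simp only [q, bilin, Pi.add_apply]
  ring

lemma q_sub (v w : V) : q (v - w) = q v - 2 * bilin v w + q w := by
  simp only [q, bilin, Pi.sub_apply]
  ring

lemma bilin_eq_q (v w : V) : bilin v w = 2 * (q (v + w) - q v - q w) := by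
  linear_combination -bilin v w * three_eq_zero - 2 * q_add v w

lemma PreservesQ.bilin_map {g : V ≃ₗ[ZMod 3] V} (hg : PreservesQ g) (v w : V) :
    bilin (g v) (g w) = bilin v w := by
  rw [bilin_eq_q, bilin_eq_q, ← map_add, hg, hg, hg]

lemma sq_eq_one_of_ne_zero : ∀ {x : ZMod 3}, x ≠ 0 → x ^ 2 = 1 := by decide

/-- Reflections, with `-2 / q u` simplified to `q u` in characteristic three. -/
def reflMap (u : V) : V →ₗ[ZMod 3] V where
  toFun v := v + (q u * bilin u v) • u
  map_add' v w := by
    ext i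
    simp only [bilin, Pi.add_apply, Pi.smul_apply, smul_eq_mul]
    ring
  map_smul' c v := by
    ext i
    simp only [bilin, Pi.add_apply, Pi.smul_apply, smul_eq_mul, RingHom.id_apply]
    ring

lemma reflMap_apply (u v : V) : reflMap u v = v + (q u * bilin u v) • u := rfl

lemma bilin_add_smul_right (u v : V) (c : ZMod 3) :
    bilin u (v + c • u) = bilin u v + c * q u := by
  simp only [bilin, q, Pi.add_apply, Pi.smul_apply, smul_eq_mul]
  ring

lemma reflMap_involutive {u : V} (hu : q u ≠ 0) : Function.Involutive (reflMap u) := by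
  intro v
  rw [reflMap_apply, reflMap_apply, bilin_add_smul_right, add_assoc, ← add_smul,
    add_eq_left]
  convert zero_smul (ZMod 3) u
  linear_combination q u * bilin u v * sq_eq_one_of_ne_zero hu +
    q u * bilin u v * three_eq_zero

/-- The reflection in an anisotropic vector. -/
def reflection (u : V) (hu : q u ≠ 0) : V ≃ₗ[ZMod 3] V :=
  LinearEquiv.ofInvolutive (reflMap u) (reflMap_involutive hu)

lemma refl_apply {u : V} (hu : q u ≠ 0) (v : V) : reflection u hu v = v + (q u * bilin u v) • u := rfl

lemma preservesQ_refl {u : V} (hu : q u ≠ 0) : PreservesQ (reflection u hu) := by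
  intro v
  rw [refl_apply, q_add_smul]
  linear_combination q u * bilin u v ^ 2 * sq_eq_one_of_ne_zero hu +
    q u * bilin u v ^ 2 * three_eq_zero

lemma bilin_e (v : V) (i : Fin 5) : bilin v (e i) = q (e i) * v i := by
  fin_cases i <;> simp [bilin, e, q]

lemma q_e_ne_zero : ∀ i, q (e i) ≠ 0 := by decide

/-- The isometries fixing the first `k` basis vectors. -/
def fixingIsometries (k : ℕ) : Subgroup (V ≃ₗ[ZMod 3] V) where
  carrier := {g | PreservesQ g ∧ ∀ i : Fin 5, i.val < k → g (e i) = e i}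
  one_mem' := ⟨fun _ => rfl, fun _ _ => rfl⟩
  mul_mem' {g h} hg hh := ⟨fun v => (hg.1 _).trans (hh.1 v), fun i hi => by
    rw [LinearEquiv.mul_apply, hh.2 i hi, hg.2 i hi]⟩
  inv_mem' {g} hg := ⟨fun v => by
      rw [← hg.1 (g⁻¹ v), ← LinearEquiv.mul_apply, mul_inv_cancel]
      rfl,
    fun i hi => by
      conv_lhs => rw [← hg.2 i hi]
      rw [← LinearEquiv.mul_apply, inv_mul_cancel]
      rfl⟩

lemma mem_fixingIsometries {k : ℕ} {g : V ≃ₗ[ZMod 3] V} :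
    g ∈ fixingIsometries k ↔ PreservesQ g ∧ ∀ i : Fin 5, i.val < k → g (e i) = e i := Iff.rfl

lemma refl_mem_fixingIsometries {k : ℕ} {u : V} (hu : q u ≠ 0)
    (huk : ∀ i : Fin 5, i.val < k → u i = 0) : reflection u hu ∈ fixingIsometries k := by
  refine ⟨preservesQ_refl hu, fun i hi => ?_⟩
  rw [refl_apply, bilin_e, huk i hi]
  simp

lemma refl_sub {v w : V} (h : q v = q w) (hu : q (v - w) ≠ 0) : reflection (v - w) hu v = w := by
  have hb : bilin (v - w) v = -q (v - w) := by
    have hb' : bilin (v - w) v = q v - bilin v w := by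
      simp only [bilin, q, Pi.sub_apply]
      ring
    linear_combination hb' + q_sub v w - h + (q v - bilin v w) * three_eq_zero
  rw [refl_apply, hb]
  have : q (v - w) * -q (v - w) = -1 := by
    linear_combination -sq_eq_one_of_ne_zero hu
  rw [this]
  simp

lemma exists_fixingIsometry {k : ℕ} {v w : V} (hq : q v = q w) (hw : q w ≠ 0)
    (hv0 : ∀ i : Fin 5, i.val < k → v i = 0) (hw0 : ∀ i : Fin 5, i.val < k → w i = 0) :
    ∃ g ∈ fixingIsometries k, g v = w := by
  by_cases h : q (v - w) = 0
  · have h' : q (v - -w) ≠ 0 := by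
      intro h0
      have : q w = 0 := by
        rw [sub_neg_eq_add, q_add] at h0
        rw [q_sub] at h
        linear_combination h + h0 - 2 * hq - q w * three_eq_zero
      exact hw this
    have h2 : q (-w - w) ≠ 0 := by
      have : -w - w = w := by
        ext i
        simp only [Pi.sub_apply, Pi.neg_apply]
        linear_combination -(w i) * three_eq_zero
      rwa [this]
    refine ⟨reflection (-w - w) h2 * reflection (v - -w) h', mul_mem ?_ ?_, ?_⟩
    · exact refl_mem_fixingIsometries _ fun i hi => by simp [hw0 i hi]
    · exact refl_mem_fixingIsometries _ fun i hi => by simp [hw0 i hi, hv0 i hi]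
    · rw [LinearEquiv.mul_apply, refl_sub (hq.trans (q_neg w).symm), refl_sub (q_neg w)]
  · exact ⟨_, refl_mem_fixingIsometries h fun i hi => by simp [hw0 i hi, hv0 i hi],
      refl_sub hq h⟩

lemma orbit_e (k : Fin 5) : MulAction.orbit (fixingIsometries k) (e k) =
    {v : V | q v = q (e k) ∧ ∀ i : Fin 5, i < k → v i = 0} := by
  have he : ∀ i : Fin 5, i < k → e k i = 0 := fun i hi => if_neg hi.ne
  ext v
  constructor
  · rintro ⟨⟨g, hg⟩, rfl⟩
    change q (g (e k)) = q (e k) ∧ ∀ i : Fin 5, i < k → g (e k) i = 0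
    refine ⟨hg.1 _, fun i hi => ?_⟩
    have h := hg.1.bilin_map (e k) (e i)
    rw [hg.2 i hi, bilin_e, bilin_e, he i hi] at h
    exact mul_left_cancel₀ (q_e_ne_zero i) h
  · rintro ⟨hq, hv⟩
    obtain ⟨g, hg, h⟩ := exists_fixingIsometry hq.symm (hq ▸ q_e_ne_zero k) he hv
    exact ⟨⟨g, hg⟩, h⟩

lemma card_fixingIsometries (k : Fin 5) : Nat.card (fixingIsometries k) =
    Fintype.card {v : V // q v = q (e k) ∧ ∀ i : Fin 5, i < k → v i = 0} *
      Nat.card (fixingIsometries (k + 1)) := by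
  have hle : fixingIsometries (k + 1) ≤ fixingIsometries k :=
    fun g hg => ⟨hg.1, fun i hi => hg.2 i (by omega)⟩
  have hstab : (fixingIsometries (k + 1)).subgroupOf (fixingIsometries k) =
      MulAction.stabilizer (fixingIsometries k) (e k) := by
    ext ⟨g, hg⟩
    rw [Subgroup.mem_subgroupOf, MulAction.mem_stabilizer_iff]
    change g ∈ fixingIsometries (k + 1) ↔ g (e k) = e k
    refine ⟨fun h => h.2 k (by omega), fun h => ⟨hg.1, fun i hi => ?_⟩⟩
    rcases Nat.lt_succ_iff_lt_or_eq.mp hi with hi | hi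
    · exact hg.2 i hi
    · rwa [Fin.ext hi]
  rw [← Subgroup.relIndex_bot_left, ← Subgroup.relIndex_bot_left,
    ← Subgroup.relIndex_mul_relIndex _ _ _ bot_le hle, mul_comm, Subgroup.relIndex, hstab, MulAction.index_stabilizer,
    orbit_e, ← Nat.card_eq_fintype_card]
  rfl

lemma linearEquiv_ext_e {g h : V ≃ₗ[ZMod 3] V} (H : ∀ i, g (e i) = h (e i)) : g = h := by
  refine LinearEquiv.toLinearMap_injective (LinearMap.pi_ext' fun i => ?_)
  ext1
  have : (LinearMap.single (ZMod 3) (fun _ : Fin 5 => ZMod 3) i) 1 = e i := by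
    ext j
    simp [e, Pi.single_apply]
  simpa only [LinearMap.comp_apply, LinearEquiv.coe_coe, this] using H i

lemma fixingIsometries_five : fixingIsometries 5 = ⊥ :=
  (Subgroup.eq_bot_iff_forall _).2 fun _ hg => linearEquiv_ext_e fun i => hg.2 i i.isLt

lemma card_isometries : Nat.card {g : V ≃ₗ[ZMod 3] V // PreservesQ g} = 103680 := by
  have h : Nat.card {g : V ≃ₗ[ZMod 3] V // PreservesQ g} = Nat.card (fixingIsometries 0) :=
    Nat.card_congr (Equiv.subtypeEquivRight fun g => by simp [mem_fixingIsometries])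
  have c0 : Fintype.card {v : V // q v = q (e 0) ∧ ∀ i : Fin 5, i < 0 → v i = 0} = 90 := by
    decide +kernel
  have c1 : Fintype.card {v : V // q v = q (e 1) ∧ ∀ i : Fin 5, i < 1 → v i = 0} = 24 := by
    decide +kernel
  have c2 : Fintype.card {v : V // q v = q (e 2) ∧ ∀ i : Fin 5, i < 2 → v i = 0} = 6 := by
    decide +kernel
  have c3 : Fintype.card {v : V // q v = q (e 3) ∧ ∀ i : Fin 5, i < 3 → v i = 0} = 4 := by
    decide +kernel
  have c4 : Fintype.card {v : V // q v = q (e 4) ∧ ∀ i : Fin 5, i < 4 → v i = 0} = 2 := by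
    decide +kernel
  have h0 := card_fixingIsometries 0
  have h1 := card_fixingIsometries 1
  have h2 := card_fixingIsometries 2
  have h3 := card_fixingIsometries 3
  have h4 := card_fixingIsometries 4
  rw [c0] at h0
  rw [c1] at h1
  rw [c2] at h2
  rw [c3] at h3
  rw [c4] at h4
  have h5 : Nat.card (fixingIsometries 5) = 1 := by rw [fixingIsometries_five, Subgroup.card_bot]
  simp only [zero_add, Nat.reduceAdd, Fin.isValue, Fin.coe_ofNat_eq_mod, Nat.reduceMod] at h0 h1 h2 h3 h4
  omega

/-- `g` acts on the basis as a signed permutation fixing the pair of `e 0`. -/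
def IsSignedPerm (g : V ≃ₗ[ZMod 3] V) : Prop :=
  ∃ σ : Equiv.Perm (Fin 5), σ 0 = 0 ∧ ∀ i, g (e i) = e (σ i) ∨ g (e i) = - e (σ i)

lemma eq_of_e_eq_or_neg : ∀ {i j : Fin 5}, e i = e j ∨ e i = -e j → i = j := by decide

lemma eq_zero_of_q_e : ∀ {i : Fin 5}, q (e i) = q (e 0) → i = 0 := by decide

lemma image_pair (g : V ≃ₗ[ZMod 3] V) (v : V) :
    ({v, -v} : Finset V).image (⇑g) = {g v, -g v} := by
  rw [Finset.image_insert, Finset.image_singleton, map_neg]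

lemma stabilizesCross_iff {g : V ≃ₗ[ZMod 3] V} (hg : PreservesQ g) :
    StabilizesCross g ↔ IsSignedPerm g := by
  constructor
  · intro h
    have key : ∀ i, ∃ j, g (e i) = e j ∨ g (e i) = -e j := by
      intro i
      have hi : ({e i, -e i} : Finset V).image (⇑g) ∈ standardCross := by
        rw [StabilizesCross] at h
        rw [← h]
        exact Finset.mem_image_of_mem _ (Finset.mem_image_of_mem _ (Finset.mem_univ i))
      obtain ⟨j, -, hj⟩ := Finset.mem_image.mp hi
      refine ⟨j, ?_⟩
      have : g (e i) ∈ ({e j, -e j} : Finset V) := by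
        rw [hj, image_pair]
        exact Finset.mem_insert_self _ _
      simpa using this
    choose f hf using key
    have hinj : Function.Injective f := by
      intro i j hij
      refine eq_of_e_eq_or_neg ?_
      have hi := hf i
      have hj := hf j
      rw [hij] at hi
      have : g (e i) = g (e j) ∨ g (e i) = g (-e j) := by
        rw [map_neg]
        rcases hi with hi | hi <;> rcases hj with hj | hj <;> simp [hi, hj]
      exact this.imp (fun h => g.injective h) fun h => g.injective h
    refine ⟨Equiv.ofBijective f (Finite.injective_iff_bijective.mp hinj), eq_zero_of_q_e ?_, hf⟩
    rw [← hg (e 0)]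
    rcases hf 0 with h0 | h0
    · rw [h0]; rfl
    · rw [h0, q_neg]; rfl
  · rintro ⟨σ, -, hσ⟩
    have hpair : ∀ i, ({e i, -e i} : Finset V).image (⇑g) = {e (σ i), -e (σ i)} := by
      intro i
      rw [image_pair]
      rcases hσ i with h | h
      · rw [h]
      · rw [h, neg_neg, Finset.pair_comm]
    ext p
    simp only [standardCross, Finset.image_image, Finset.mem_image, Finset.mem_univ, true_and,
      Function.comp_apply, hpair]
    exact σ.exists_congr_left.trans (by simp)

/-- The signed permutation `e i ↦ ε (σ i) • e (σ i)`. -/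
def signedPerm (σ : Equiv.Perm (Fin 5)) (ε : Fin 5 → (ZMod 3)ˣ) : V ≃ₗ[ZMod 3] V :=
  (LinearEquiv.funCongrLeft (ZMod 3) (ZMod 3) σ.symm).trans
    (LinearEquiv.piCongrRight fun i => LinearEquiv.smulOfUnit (ε i))

lemma signedPerm_apply (σ : Equiv.Perm (Fin 5)) (ε : Fin 5 → (ZMod 3)ˣ) (v : V) (j : Fin 5) :
    signedPerm σ ε v j = ε j * v (σ.symm j) := rfl

lemma signedPerm_e (σ : Equiv.Perm (Fin 5)) (ε : Fin 5 → (ZMod 3)ˣ) (i : Fin 5) :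
    signedPerm σ ε (e i) = (ε (σ i) : ZMod 3) • e (σ i) := by
  ext j
  rw [signedPerm_apply, Pi.smul_apply, smul_eq_mul]
  by_cases h : j = σ i
  · simp [h, e]
  · simp [h, e, Equiv.symm_apply_eq]

lemma unit_eq_one_or_neg : ∀ u : (ZMod 3)ˣ, (u : ZMod 3) = 1 ∨ (u : ZMod 3) = -1 := by decide

lemma q_eq_sum (v : V) : q v = ∑ i, (if i = 0 then 1 else -1) * v i ^ 2 := by
  simp [Fin.sum_univ_five, q, sub_eq_add_neg]

lemma preservesQ_signedPerm {σ : Equiv.Perm (Fin 5)} (hσ : σ 0 = 0) (ε : Fin 5 → (ZMod 3)ˣ) :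
    PreservesQ (signedPerm σ ε) := by
  intro v
  rw [q_eq_sum, q_eq_sum, ← Equiv.sum_comp σ]
  refine Finset.sum_congr rfl fun i _ => ?_
  have h0 : σ i = 0 ↔ i = 0 := by rw [← σ.injective.eq_iff (a := i), hσ]
  rw [signedPerm_apply, mul_pow, sq_eq_one_of_ne_zero (ε (σ i)).ne_zero, Equiv.symm_apply_apply,
    one_mul]
  simp only [h0]

lemma isSignedPerm_signedPerm {σ : Equiv.Perm (Fin 5)} (hσ : σ 0 = 0) (ε : Fin 5 → (ZMod 3)ˣ) :
    IsSignedPerm (signedPerm σ ε) := by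
  refine ⟨σ, hσ, fun i => ?_⟩
  rw [signedPerm_e]
  exact (unit_eq_one_or_neg (ε (σ i))).imp (fun h => by rw [h, one_smul])
    fun h => by rw [h, neg_one_smul]

lemma eq_of_smul_e_eq : ∀ {i j : Fin 5} {u w : (ZMod 3)ˣ},
    (u : ZMod 3) • e i = (w : ZMod 3) • e j → i = j ∧ u = w := by decide

lemma signedPerm_injective {σ τ : Equiv.Perm (Fin 5)} {ε δ : Fin 5 → (ZMod 3)ˣ}
    (h : signedPerm σ ε = signedPerm τ δ) : σ = τ ∧ ε = δ := by
  have key : ∀ i, σ i = τ i ∧ ε (σ i) = δ (τ i) := fun i =>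
    eq_of_smul_e_eq (by rw [← signedPerm_e, ← signedPerm_e, h])
  obtain rfl : σ = τ := Equiv.ext fun i => (key i).1
  refine ⟨rfl, funext fun j => ?_⟩
  simpa using (key (σ.symm j)).2

lemma IsSignedPerm.exists_eq {g : V ≃ₗ[ZMod 3] V} (hg : IsSignedPerm g) :
    ∃ σ : Equiv.Perm (Fin 5), σ 0 = 0 ∧ ∃ ε, signedPerm σ ε = g := by
  obtain ⟨σ, h0, hσ⟩ := hg
  have key : ∀ i, ∃ u : (ZMod 3)ˣ, g (e i) = (u : ZMod 3) • e (σ i) := fun i =>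
    (hσ i).elim (fun h => ⟨1, by simp [h]⟩) fun h => ⟨-1, by simp [h]⟩
  choose ε hε using key
  refine ⟨σ, h0, ε ∘ σ.symm, linearEquiv_ext_e fun i => ?_⟩
  rw [signedPerm_e, hε, Function.comp_apply, Equiv.symm_apply_apply]

lemma card_crossStabilizer :
    Nat.card {g : V ≃ₗ[ZMod 3] V // PreservesQ g ∧ StabilizesCross g} = 768 := by
  let f : {σ : Equiv.Perm (Fin 5) // σ 0 = 0} × (Fin 5 → (ZMod 3)ˣ) →
      {g : V ≃ₗ[ZMod 3] V // PreservesQ g ∧ StabilizesCross g} := fun p =>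
    ⟨signedPerm p.1 p.2, preservesQ_signedPerm p.1.2 _,
      (stabilizesCross_iff (preservesQ_signedPerm p.1.2 _)).2 (isSignedPerm_signedPerm p.1.2 _)⟩
  have hf : Function.Bijective f := by
    constructor
    · intro p p' h
      obtain ⟨h1, h2⟩ := signedPerm_injective (Subtype.ext_iff.mp h)
      exact Prod.ext (Subtype.ext h1) h2
    · rintro ⟨g, hg, hs⟩
      obtain ⟨σ, h0, ε, rfl⟩ := ((stabilizesCross_iff hg).1 hs).exists_eq
      exact ⟨(⟨σ, h0⟩, ε), rfl⟩
  have hσ : Fintype.card {σ : Equiv.Perm (Fin 5) // σ 0 = 0} = 24 := by decide +kernel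
  have hu : Fintype.card (ZMod 3)ˣ = 2 := by decide
  rw [← Nat.card_congr (Equiv.ofBijective f hf), Nat.card_prod, Nat.card_eq_fintype_card, hσ,
    Nat.card_eq_fintype_card, Fintype.card_fun, hu, Fintype.card_fin]
  norm_num

theorem stmt19 :
    Nat.card {g : V ≃ₗ[ZMod 3] V // PreservesQ g} = 103680 ∧
    Nat.card {g : V ≃ₗ[ZMod 3] V // PreservesQ g ∧ StabilizesCross g} = 768 ∧
    103680 = 768 * 135 ∧
    (∀ g : V ≃ₗ[ZMod 3] V, PreservesQ g →
      (StabilizesCross g ↔ ∃ σ : Equiv.Perm (Fin 5), σ 0 = 0 ∧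
        ∀ i, g (e i) = e (σ i) ∨ g (e i) = - e (σ i))) := by
  exact ⟨card_isometries, card_crossStabilizer, by norm_num, fun _ hg => stabilizesCross_iff hg⟩
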